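/- arXiv:1105.1380 — 11 statements merged into one kernel-verified Lean document; each statement's English description precedes it below -/
import Mathlib

section
/- Let g, h ∈ ℝ[X] be real polynomials and let b ∈ ℝ with h(b) ≠ 0. Suppose that for every ε > 0 there exists v with 0 < v < ε such that g(b+v)·h(b−v) = g(b−v)·h(b+v) (i.e., the rational function f = g/h satisfies f(b+v) = f(b−v) whenever both sides are defined). Then the derivative of the function x ↦ g(x)/h(x) at b is 0. -/
/-- If `g, h ∈ ℝ[X]`, `h(b) ≠ 0`, and there are positive `v`
arbitrarily close to `0` with `g(b+v)·h(b−v) = g(b−v)·h(b+v)`, then the derivative of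
`x ↦ g(x)/h(x)` at `b` is `0`. -/
theorem stmt_0 (g h : Polynomial ℝ) (b : ℝ) (hb : h.eval b ≠ 0)
    (hsym : ∀ ε > (0:ℝ), ∃ v : ℝ, 0 < v ∧ v < ε ∧
      g.eval (b + v) * h.eval (b - v) = g.eval (b - v) * h.eval (b + v)) :
    deriv (fun x : ℝ => g.eval x / h.eval x) b = 0 := by
  have hg : ∀ x, HasDerivAt (fun y : ℝ => g.eval y) (g.derivative.eval x) x := fun x => g.hasDerivAt x
  have hh : ∀ x, HasDerivAt (fun y : ℝ => h.eval y) (h.derivative.eval x) x := fun x => h.hasDerivAt x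
  have key : g.derivative.eval b * h.eval b - g.eval b * h.derivative.eval b = 0 := by
    by_contra hne
    have hp : HasDerivAt (fun v : ℝ => b + v) 1 0 := (hasDerivAt_id (0:ℝ)).const_add b
    have hm : HasDerivAt (fun v : ℝ => b - v) (-1) 0 := (hasDerivAt_id (0:ℝ)).const_sub b
    have gp := (hg (b + 0)).comp (0:ℝ) hp
    have gm := (hg (b - 0)).comp (0:ℝ) hm
    have hp' := (hh (b + 0)).comp (0:ℝ) hp
    have hm' := (hh (b - 0)).comp (0:ℝ) hm
    have hF := (gp.mul hm').sub (gm.mul hp')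
    have hev := hF.eventually_ne (c := 0) (by
      simp only [Function.comp, add_zero, sub_zero]
      intro h0
      apply hne
      linarith)
    rw [eventually_nhdsWithin_iff, Metric.eventually_nhds_iff] at hev
    obtain ⟨ε, hε, H⟩ := hev
    obtain ⟨v, hv0, hvε, hv⟩ := hsym ε hε
    refine H (y := v) ?_ (by simpa using hv0.ne') ?_
    · simpa [Real.dist_eq, abs_of_pos hv0] using hvε
    · simp [Function.comp, hv]
  have := ((hg b).div (hh b) hb).deriv
  rw [key, zero_div] at this
  exact this
end

section
/- Let Q be a subfield of ℝ, let p be a prime number, let d ≥ 2, and let α ∈ ℝ be the positive real number with α^d = p; assume [Q(α) : Q] = d. Let g, h ∈ Q[X] be polynomials such that g is not a Q-scalar multiple of h (so the rational function f = g/h is nonconstant), and let b ∈ ℚ be such that h(b) ≠ 0 and the derivative of x ↦ g(x)/h(x) at b is nonzero. Then the set of rational numbers c such that h(b + cα) ≠ 0 and the element β_c = g(b+cα)/h(b+cα) has degree strictly less than d over Q is finite. -/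
set_option synthInstance.maxHeartbeats 1000000
set_option maxHeartbeats 1000000
open Polynomial in
/-- A separable irreducible polynomial of a non-rational element has another complex root. -/
theorem exists_other_root (F : Subfield ℝ) (α : ℝ) (hint : IsIntegral F α) (hα : α ∉ F) :
    ∃ z : ℂ, z ≠ (α : ℂ) ∧
      ((minpoly F α).map (Complex.ofRealHom.comp (algebraMap F ℝ))).eval z = 0 := by
  set φ : F →+* ℂ := Complex.ofRealHom.comp (algebraMap F ℝ)
  have hsep : ((minpoly F α).map φ).Separable := (minpoly.irreducible hint).separable.map
  by_contra hcon
  push Not at hcon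
  have hne : (minpoly F α).map φ ≠ 0 := hsep.ne_zero
  have hall : ∀ z ∈ ((minpoly F α).map φ).roots, z = (α : ℂ) := by
    intro z hz
    by_contra hzα
    exact hcon z hzα ((mem_roots hne).1 hz)
  have hrep := Multiset.eq_replicate_card.2 hall
  have hnd : ((minpoly F α).map φ).roots.Nodup := nodup_roots hsep
  have hcard : Multiset.card ((minpoly F α).map φ).roots ≤ 1 := by
    rw [hrep] at hnd
    rw [← Multiset.coe_replicate, Multiset.coe_nodup, List.nodup_replicate] at hnd
    exact hnd
  have hc2 : Multiset.card ((minpoly F α).map φ).roots = ((minpoly F α).map φ).natDegree :=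
    (splits_iff_card_roots.1 (IsAlgClosed.splits _))
  rw [hc2, natDegree_map] at hcard
  have h1 : (minpoly F α).natDegree = 1 := le_antisymm hcard (minpoly.natDegree_pos hint)
  have h2 := minpoly.natDegree_eq_one_iff.1 h1
  obtain ⟨y, hy⟩ := h2
  exact hα (hy ▸ y.2)

open Polynomial

/-- Lemma on roots: Let `Q ⊆ ℝ` be a subfield, `p` prime, `d ≥ 2`,
`α > 0` with `α^d = p` and `[Q(α):Q] = d`.  Let `f = g/h` be a nonconstant rational
function over `Q` and `b ∈ ℚ` with `h(b) ≠ 0` and `f'(b) ≠ 0`.  Then the set of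
rationals `c` such that `h(b+cα) ≠ 0` and `β_c = f(b+cα)` has degree `< d` over `Q`
is finite. -/
theorem stmt_2 (Q : Subfield ℝ) (p : ℕ) (hp : p.Prime) (d : ℕ) (hd : 2 ≤ d)
    (α : ℝ) (hα : 0 < α) (hαd : α ^ d = (p : ℝ))
    (hdeg : Module.finrank Q (IntermediateField.adjoin Q {α} : IntermediateField Q ℝ) = d)
    (g h : Polynomial Q)
    (hnc : ∀ c : Q, g ≠ c • h)
    (b : ℚ) (hb : Polynomial.aeval (b : ℝ) h ≠ 0)
    (hderiv : deriv (fun x : ℝ => Polynomial.aeval x g / Polynomial.aeval x h) b ≠ 0) :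
    {c : ℚ | Polynomial.aeval ((b : ℝ) + c * α) h ≠ 0 ∧
      Module.finrank Q (IntermediateField.adjoin Q
        {Polynomial.aeval ((b : ℝ) + c * α) g / Polynomial.aeval ((b : ℝ) + c * α) h} :
        IntermediateField Q ℝ) < d}.Finite := by
  classical
  set ψ : Q →+* ℂ := Complex.ofRealHom.comp (algebraMap Q ℝ) with hψ
  set G : Polynomial ℂ := g.map ψ with hG
  set H : Polynomial ℂ := h.map ψ with hH
  have hGe : ∀ x : ℝ, G.eval (x : ℂ) = ((aeval x g : ℝ) : ℂ) := by
    intro x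
    rw [hG, eval_map, aeval_def, hψ]
    exact (hom_eval₂ g (algebraMap Q ℝ) Complex.ofRealHom x).symm
  have hHe : ∀ x : ℝ, H.eval (x : ℂ) = ((aeval x h : ℝ) : ℂ) := by
    intro x
    rw [hH, eval_map, aeval_def, hψ]
    exact (hom_eval₂ h (algebraMap Q ℝ) Complex.ofRealHom x).symm
  have hGe' : ∀ x : ℝ, G.derivative.eval (x : ℂ) = ((aeval x g.derivative : ℝ) : ℂ) := by
    intro x
    rw [hG, derivative_map, eval_map, aeval_def, hψ]
    exact (hom_eval₂ _ (algebraMap Q ℝ) Complex.ofRealHom x).symm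
  have hHe' : ∀ x : ℝ, H.derivative.eval (x : ℂ) = ((aeval x h.derivative : ℝ) : ℂ) := by
    intro x
    rw [hH, derivative_map, eval_map, aeval_def, hψ]
    exact (hom_eval₂ _ (algebraMap Q ℝ) Complex.ofRealHom x).symm
  have hW : aeval (b : ℝ) g.derivative * aeval (b : ℝ) h
      - aeval (b : ℝ) g * aeval (b : ℝ) h.derivative ≠ 0 := by
    intro h0
    apply hderiv
    have := ((g.hasDerivAt_aeval (b : ℝ)).fun_div (h.hasDerivAt_aeval (b : ℝ)) hb).deriv
    rw [this, h0, zero_div]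
  set P : ℂ → Polynomial ℂ := fun z =>
    G.comp (C (b : ℂ) + C z * X) * H.comp (C (b : ℂ) + C (α : ℂ) * X)
      - G.comp (C (b : ℂ) + C (α : ℂ) * X) * H.comp (C (b : ℂ) + C z * X) with hP
  have hPne : ∀ z : ℂ, z ≠ α → P z ≠ 0 := by
    intro z hz h0
    have h1 : (P z).derivative.eval 0 = 0 := by rw [h0]; simp
    have hbG := hGe b
    have hbH := hHe b
    have hbG' := hGe' b
    have hbH' := hHe' b
    push_cast at hbG hbH hbG' hbH'
    simp only [hP, derivative_sub, derivative_mul, derivative_comp, derivative_add, derivative_C,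
      derivative_X, eval_sub, eval_mul, eval_add, eval_comp, eval_C, eval_X, mul_zero, add_zero,
      zero_mul, zero_add, mul_one, eval_zero, hbG, hbH, hbG', hbH'] at h1
    have h2 : (z - α) * (((aeval (b : ℝ) g.derivative * aeval (b : ℝ) h
      - aeval (b : ℝ) g * aeval (b : ℝ) h.derivative : ℝ)) : ℂ) = 0 := by
      push_cast
      linear_combination h1
    rcases mul_eq_zero.1 h2 with h3 | h3
    · exact hz (sub_eq_zero.1 h3)
    · exact hW (by exact_mod_cast h3)
  have hp0 : (X ^ d - C (p : ℂ) : Polynomial ℂ) ≠ 0 := X_pow_sub_C_ne_zero (by omega) _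
  have hfin : (⋃ z ∈ {z : ℂ | z ∈ (X ^ d - C (p : ℂ) : Polynomial ℂ).roots.toFinset ∧ z ≠ α},
      (fun c : ℚ => (c : ℂ)) ⁻¹' {w : ℂ | w ∈ (P z).roots.toFinset}).Finite := by
    apply Set.Finite.biUnion
    · exact (Finset.finite_toSet _).subset (fun z hz => hz.1)
    · intro z hz
      exact Set.Finite.preimage (Rat.cast_injective.injOn) (Finset.finite_toSet _)
  refine hfin.subset ?_
  rintro c ⟨hc, hcd⟩
  set β : ℝ := aeval ((b : ℝ) + c * α) g / aeval ((b : ℝ) + c * α) h with hβ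
  set F : IntermediateField Q ℝ := IntermediateField.adjoin Q {β} with hF
  have hβF : β ∈ F := IntermediateField.mem_adjoin_simple_self Q β
  have hQF : ∀ x : Q, (x : ℝ) ∈ F := fun x => F.algebraMap_mem x
  have hαQ : IsIntegral Q α := by
    refine ⟨X ^ d - C (p : Q), monic_X_pow_sub_C _ (by omega), ?_⟩
    simp [hαd]
  have hK : β ∈ IntermediateField.adjoin Q {α} := by
    have hαK := IntermediateField.mem_adjoin_simple_self Q α
    have hx : (b : ℝ) + c * α ∈ IntermediateField.adjoin Q {α} :=
      add_mem (SubfieldClass.ratCast_mem _ b) (mul_mem (SubfieldClass.ratCast_mem _ c) hαK)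
    have hev : ∀ q : Polynomial Q, aeval ((b : ℝ) + c * α) q ∈ IntermediateField.adjoin Q {α} := by
      intro q
      have e := aeval_algebraMap_apply ℝ (⟨_, hx⟩ : IntermediateField.adjoin Q {α}) q
      exact e ▸ (aeval (⟨_, hx⟩ : IntermediateField.adjoin Q {α}) q).2
    exact div_mem (hev g) (hev h)
  have hαF : α ∉ F := by
    intro hmem
    have : F = IntermediateField.adjoin Q {α} :=
      le_antisymm (IntermediateField.adjoin_simple_le_iff.2 hK)
        (IntermediateField.adjoin_simple_le_iff.2 hmem)
    rw [this, hdeg] at hcd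
    exact lt_irrefl _ hcd
  have hint : IsIntegral F.toSubfield α := by
    refine ⟨X ^ d - C (p : F.toSubfield), monic_X_pow_sub_C _ (by omega), ?_⟩
    simp [hαd]
  obtain ⟨z, hz, hroot⟩ := exists_other_root F.toSubfield α hint hαF
  set φ : F.toSubfield →+* ℂ := Complex.ofRealHom.comp (algebraMap F.toSubfield ℝ) with hφ
  have hvan : ∀ q : Polynomial F.toSubfield, aeval α q = 0 → (q.map φ).eval z = 0 := by
    intro q hq
    obtain ⟨r, rfl⟩ := minpoly.dvd _ _ hq
    rw [Polynomial.map_mul, eval_mul, hroot, zero_mul]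
  have hzp : z ^ d = p := by
    have := hvan (X ^ d - C (p : F.toSubfield)) (by simp [hαd])
    simpa [sub_eq_zero] using this
  let ι : Q →+* F.toSubfield := (algebraMap Q ℝ).codRestrict F.toSubfield hQF
  have hι1 : φ.comp ι = ψ := rfl
  have hι2 : (algebraMap F.toSubfield ℝ).comp ι = algebraMap Q ℝ := rfl
  let L : Polynomial F.toSubfield := C (b : F.toSubfield) + C (c : F.toSubfield) * X
  have hβh : β * aeval ((b : ℝ) + c * α) h = aeval ((b : ℝ) + c * α) g := div_mul_cancel₀ _ hc
  have hLα : aeval α L = (b : ℝ) + c * α := by simp [L]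
  have hLm : L.map φ = C (b : ℂ) + C (c : ℂ) * X := by simp [L]
  have hkey : G.eval (b + c * z) = (β : ℂ) * H.eval (b + c * z) := by
    have h1 := hvan (C ⟨β, hβF⟩ * (h.map ι).comp L - (g.map ι).comp L) (by
      have e : ∀ q : Polynomial Q, aeval α ((q.map ι).comp L) = aeval ((b : ℝ) + c * α) q := by
        intro q
        rw [aeval_comp, hLα, aeval_def, eval₂_map, hι2, aeval_def]
      rw [map_sub, map_mul, e, e, aeval_C, ← hβh]
      exact sub_self _)
    rw [Polynomial.map_sub, Polynomial.map_mul, map_comp, map_comp, Polynomial.map_map,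
      Polynomial.map_map, hι1, hLm, map_C, eval_sub, eval_mul, eval_comp, eval_comp, eval_C] at h1
    simp only [eval_add, eval_mul, eval_C, eval_X] at h1
    exact (sub_eq_zero.1 h1).symm
  have hkey2 : G.eval ((b : ℂ) + c * (α : ℂ)) = (β : ℂ) * H.eval ((b : ℂ) + c * (α : ℂ)) := by
    have e1 := hGe (b + c * α)
    have e2 := hHe (b + c * α)
    push_cast at e1 e2
    rw [e1, e2, ← hβh]
    push_cast
    rfl
  simp only [Set.mem_iUnion]
  refine ⟨z, ⟨?_, hz⟩, ?_⟩
  · rw [Multiset.mem_toFinset, mem_roots hp0]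
    simp [hzp]
  · show (c : ℂ) ∈ (P z).roots.toFinset
    rw [Multiset.mem_toFinset, mem_roots (hPne z hz)]
    simp only [hP, IsRoot.def, eval_sub, eval_mul, eval_comp, eval_add, eval_C, eval_X]
    rw [mul_comm z, mul_comm (α : ℂ), hkey, hkey2]
    ring
end

section
/- Let Q be a subfield of ℝ which is finitely generated as a field (i.e., finitely generated as a field extension of ℚ), and let d ≥ 1. Then there exists a prime number p such that the positive real d-th root α of p satisfies [Q(α) : Q] = d. -/
set_option synthInstance.maxHeartbeats 1000000
set_option maxHeartbeats 1000000

open IntermediateField in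
lemma aux_norm {F L : Type*} [Field F] [Field L] [Algebra F L]
    (φ : L →+* ℝ) (r : L) (hr : 0 < φ r) (d : ℕ) (hd : d ≠ 0) (a : F)
    (h : r ^ d = algebraMap F L a) :
    ∃ b : F, algebraMap F L b = r ^ (Module.finrank F L) := by
  have h1 : (Algebra.norm F r) ^ d = a ^ Module.finrank F L := by
    rw [← map_pow, h, Algebra.norm_algebraMap]
  have h2 : (φ (algebraMap F L (Algebra.norm F r))) ^ d = (φ r ^ Module.finrank F L) ^ d := by
    rw [← map_pow, ← map_pow, h1, map_pow, ← h, ← map_pow, ← map_pow, ← pow_mul, ← pow_mul, mul_comm]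
  have h3 : |φ (algebraMap F L (Algebra.norm F r))| = φ r ^ Module.finrank F L := by
    have := congrArg abs h2
    rw [abs_pow, abs_of_pos (a := (φ r ^ Module.finrank F L) ^ d) (by positivity)] at this
    exact (pow_left_inj₀ (abs_nonneg _) (by positivity) hd).1 this
  rcases abs_choice (φ (algebraMap F L (Algebra.norm F r))) with h4 | h4
  · refine ⟨Algebra.norm F r, φ.injective ?_⟩
    rw [map_pow, ← h3, h4]
  · refine ⟨- Algebra.norm F r, φ.injective ?_⟩
    rw [map_pow, ← h3, h4, map_neg, map_neg]

open IntermediateField Polynomial in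
lemma aux_trace {F L : Type*} [Field F] [Field L] [Algebra F L] [FiniteDimensional F L]
    (φ : L →+* ℝ) (r : L) (hr : 0 < φ r) (d : ℕ) (hd : d ≠ 0) (a : F)
    (h : r ^ d = algebraMap F L a) (hn : r ∉ (algebraMap F L).range) :
    Algebra.trace F L r = 0 := by
  have hi : IsIntegral F r := IsIntegral.of_finite F r
  obtain ⟨b, hb⟩ := aux_norm (F := F) (L := F⟮r⟯) (φ.comp (algebraMap F⟮r⟯ L))
    (AdjoinSimple.gen F r) (by simpa using hr) d hd a (by
      apply (algebraMap F⟮r⟯ L).injective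
      rw [map_pow, AdjoinSimple.algebraMap_gen, h]; rfl)
  have hb' : algebraMap F L b = r ^ Module.finrank F F⟮r⟯ := by
    have := congrArg (algebraMap F⟮r⟯ L) hb
    rw [map_pow, AdjoinSimple.algebraMap_gen] at this
    rw [← this]; rfl
  rw [adjoin.finrank hi] at hb'
  have hm : minpoly F r = X ^ (minpoly F r).natDegree - C b := by
    have hpos := minpoly.natDegree_pos hi
    have hmp := minpoly.monic hi
    have hdv : ∀ q : F[X], aeval r q = 0 → minpoly F r ∣ q := fun q hq => minpoly.dvd F r hq
    generalize hq : minpoly F r = q at *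
    generalize hk : q.natDegree = k at *
    have hmon : (X ^ k - C b : F[X]).Monic := monic_X_pow_sub_C b hpos.ne'
    refine (Polynomial.eq_of_monic_of_dvd_of_natDegree_le hmp hmon ?_ ?_).symm
    · apply hdv
      rw [map_sub, map_pow, aeval_X, aeval_C, hb', sub_self]
    · rw [natDegree_X_pow_sub_C, hk]
  have h2 : 2 ≤ (minpoly F r).natDegree := by
    have h0 := minpoly.natDegree_pos hi
    have h1 : (minpoly F r).natDegree ≠ 1 := fun h => hn (minpoly.natDegree_eq_one_iff.1 h)
    omega
  rw [trace_eq_trace_adjoin, trace_adjoinSimpleGen hi]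
  have : (minpoly F r).nextCoeff = 0 := by
    rw [nextCoeff_of_natDegree_pos (by omega)]
    have : (minpoly F r).coeff ((minpoly F r).natDegree - 1) =
      (X ^ (minpoly F r).natDegree - C b : F[X]).coeff ((minpoly F r).natDegree - 1) := by rw [← hm]
    rw [this, coeff_sub, coeff_X_pow, coeff_C, if_neg (by omega), if_neg (by omega), sub_zero]
  simp [this]

open IntermediateField Polynomial in
open scoped IntermediateField.algebraAdjoinAdjoin in
lemma aux_alg {k L ι : Type*} [Field k] [Field L] [Algebra k L] (x : ι → L) (hx : AlgebraicIndependent k x)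
    (r : L) (d : ℕ) (hd : d ≠ 0) (a : k) (ha : a ≠ 0) (h : r ^ d = algebraMap k L a)
    (hr : r ∈ adjoin k (Set.range x)) : ∃ b : k, r = algebraMap k L b := by
  let A := Algebra.adjoin k (Set.range x)
  let e := hx.aevalEquiv
  have : IsIntegrallyClosed A := IsIntegrallyClosed.of_equiv e.toRingEquiv
  let K := adjoin k (Set.range x)
  let r' : K := ⟨r, hr⟩
  have hr' : r' ^ d = algebraMap k K a := Subtype.ext h
  have hint : IsIntegral A r' := by
    refine IsIntegral.of_pow (n := d) (by omega) ?_
    rw [hr', IsScalarTower.algebraMap_apply k A K]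
    exact isIntegral_algebraMap
  obtain ⟨y, hy⟩ := IsIntegrallyClosed.isIntegral_iff.1 hint
  have hyd : y ^ d = algebraMap k A a := by
    apply FaithfulSMul.algebraMap_injective A K
    rw [map_pow, hy, hr', IsScalarTower.algebraMap_apply k A K]
  have hu : IsUnit (e.symm y) := by
    have : IsUnit (y ^ d) := by
      rw [hyd]; exact (IsUnit.mk0 a ha).map _
    exact ((isUnit_pow_iff hd).1 this).map e.symm
  obtain ⟨b, hb, hb'⟩ := MvPolynomial.isUnit_iff_eq_C_of_isReduced.1 hu
  refine ⟨b, ?_⟩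
  have h1 : y = algebraMap k A b := by
    rw [← e.apply_symm_apply y, hb', ← MvPolynomial.algebraMap_eq]
    exact e.commutes b
  have h2 := congrArg (algebraMap K L) hy
  rw [h1] at h2
  exact h2.symm

lemma aux_val (p q : ℕ) (hp : p.Prime) (hq : q.Prime) (hpq : p ≠ q) (m n d : ℕ) (hm : 0 < m)
    (hmd : m < d) (b : ℚ) (h : b ^ d * (q : ℚ) ^ n = (p : ℚ) ^ m) : False := by
  have := Fact.mk hp
  have := Fact.mk hq
  have hp0 : (p : ℚ) ≠ 0 := by exact_mod_cast hp.ne_zero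
  have hq0 : (q : ℚ) ≠ 0 := by exact_mod_cast hq.ne_zero
  have hb : b ≠ 0 := by
    rintro rfl
    rw [zero_pow (by omega), zero_mul] at h
    exact pow_ne_zero m hp0 h.symm
  have h1 := congrArg (padicValRat p) h
  have hv : padicValRat p (q : ℚ) = 0 := by
    rw [padicValRat.of_nat, padicValNat_primes hpq]; rfl
  rw [padicValRat.mul (pow_ne_zero _ hb) (pow_ne_zero _ hq0), padicValRat.pow,
    padicValRat.pow, padicValRat.pow, hv, padicValRat.self hp.one_lt] at h1
  have h2 : (d : ℤ) ∣ m := ⟨padicValRat p b, by linarith⟩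
  have h3 := Nat.le_of_dvd hm (Int.natCast_dvd_natCast.1 h2)
  omega

open IntermediateField in
lemma aux_main (L : Type) [Field L] [Algebra ℚ L] [Algebra.EssFiniteType ℚ L] (φ : L →+* ℝ)
    (d : ℕ) (m : Nat.Primes → ℕ) (γ : Nat.Primes → L) (hm : ∀ p, 0 < m p) (hmd : ∀ p, m p < d)
    (hγ : ∀ p, 0 < φ (γ p)) (h : ∀ p : Nat.Primes, γ p ^ d = ((p : ℕ) : L) ^ m p) : False := by
  have hd : d ≠ 0 := by have := hmd ⟨2, Nat.prime_two⟩; omega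
  obtain ⟨s, hs⟩ := exists_isTranscendenceBasis ℚ L
  let F := adjoin ℚ (Set.range (Subtype.val : s → L))
  have halg : Algebra.IsAlgebraic F L := hs.isAlgebraic_field
  have : Algebra.EssFiniteType F L := Algebra.EssFiniteType.of_comp ℚ F L
  have : FiniteDimensional F L := Algebra.finite_of_essFiniteType_of_isAlgebraic
  have : CharZero L := algebraRat.charZero L
  have hγ0 : ∀ p, γ p ≠ 0 := fun p hp => by have := hγ p; simp [hp] at this
  have hli : LinearIndependent F γ := by
    rw [linearIndependent_iff']
    intro t g hg j hj
    have h1 : ∑ i ∈ t, g i • (γ i * (γ j)⁻¹) = 0 := by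
      have := congrArg (· * (γ j)⁻¹) hg
      simpa [Finset.sum_mul, smul_mul_assoc] using this
    have h2 := congrArg (Algebra.trace F L) h1
    rw [map_sum, map_zero, Finset.sum_eq_single j] at h2
    · rw [map_smul, mul_inv_cancel₀ (hγ0 j)] at h2
      have h3 : Algebra.trace F L 1 = (Module.finrank F L : F) := by
        have := Algebra.trace_algebraMap (R := F) (S := L) (1 : F)
        simpa using this
      rw [h3, smul_eq_mul] at h2
      rcases mul_eq_zero.1 h2 with h4 | h4
      · exact h4
      · exact absurd (Nat.cast_eq_zero.1 h4) Module.finrank_pos.ne'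
    · intro i _ hij
      have hpow : (γ i * (γ j)⁻¹) ^ d =
          algebraMap ℚ L (((i : ℕ) : ℚ) ^ m i * (((j : ℕ) : ℚ) ^ m j)⁻¹) := by
        rw [mul_pow, inv_pow, h, h]; simp
      have hi0 : ((i : ℕ) : ℚ) ≠ 0 := by exact_mod_cast i.2.ne_zero
      have hj0 : ((j : ℕ) : ℚ) ≠ 0 := by exact_mod_cast j.2.ne_zero
      rw [map_smul, aux_trace φ (γ i * (γ j)⁻¹) ?_ d hd
        (algebraMap ℚ F (((i : ℕ) : ℚ) ^ m i * (((j : ℕ) : ℚ) ^ m j)⁻¹)) ?_ ?_, smul_zero]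
      · rw [map_mul, map_inv₀]; exact mul_pos (hγ i) (inv_pos.2 (hγ j))
      · rw [hpow, ← IsScalarTower.algebraMap_apply ℚ F L]
      · rintro ⟨y, hy⟩
        obtain ⟨b, hb⟩ := aux_alg _ hs.1 (γ i * (γ j)⁻¹) d hd _
          (mul_ne_zero (pow_ne_zero _ hi0) (inv_ne_zero (pow_ne_zero _ hj0))) hpow
          (by rw [← hy]; exact y.2)
        refine aux_val i j i.2 j.2 (fun h => hij (Subtype.ext h)) (m i) (m j) d (hm i) (hmd i) b ?_
        rw [hb, ← map_pow] at hpow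
        rw [(algebraMap ℚ L).injective hpow, mul_assoc, inv_mul_cancel₀ (pow_ne_zero _ hj0), mul_one]
    · intro hn; exact absurd hj hn
  have := hli.finite
  exact not_finite Nat.Primes

/-- If `Q ⊆ ℝ` is a finitely generated subfield and `d ≥ 1`, then
there is a prime `p` whose positive real `d`-th root `α` satisfies `[Q(α):Q] = d`. -/
theorem stmt_3 (Q : IntermediateField ℚ ℝ) (hfg : Q.FG) (d : ℕ) (hd : 1 ≤ d) :
    ∃ p : ℕ, p.Prime ∧ ∀ α : ℝ, 0 < α → α ^ d = (p : ℝ) →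
      Module.finrank Q (IntermediateField.adjoin Q {α} : IntermediateField Q ℝ) = d := by
  by_contra! hcon
  have key : ∀ p : Nat.Primes, ∃ m : ℕ, ∃ γ : Q, 0 < m ∧ m < d ∧ 0 < (algebraMap Q ℝ) γ ∧
      γ ^ d = ((p : ℕ) : Q) ^ m := by
    intro p
    obtain ⟨α, hα, hαd, hne⟩ := hcon p p.2
    have haeval : Polynomial.aeval α (Polynomial.X ^ d - Polynomial.C ((p : ℕ) : Q)) = 0 := by
      simp [hαd]
    have hmon := Polynomial.monic_X_pow_sub_C (((p : ℕ) : Q)) (show d ≠ 0 by omega)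
    have hi : IsIntegral Q α := ⟨_, hmon, haeval⟩
    have hfin := IntermediateField.adjoin.finrank hi
    have hle : (minpoly Q α).natDegree ≤ d := by
      have := Polynomial.natDegree_le_of_dvd (minpoly.dvd Q α haeval) hmon.ne_zero
      rwa [Polynomial.natDegree_X_pow_sub_C] at this
    have hpos := minpoly.natDegree_pos hi
    obtain ⟨b, hb⟩ := aux_norm (F := Q) (L := IntermediateField.adjoin Q {α})
      (algebraMap _ ℝ) (IntermediateField.AdjoinSimple.gen Q α) (by simpa using hα) d (by omega)
      ((p : ℕ) : Q) (by
        apply (algebraMap (IntermediateField.adjoin Q {α}) ℝ).injective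
        rw [map_pow, IntermediateField.AdjoinSimple.algebraMap_gen, hαd]; simp)
    have hb' : algebraMap Q ℝ b = α ^ (minpoly Q α).natDegree := by
      have := congrArg (algebraMap (IntermediateField.adjoin Q {α}) ℝ) hb
      rw [map_pow, IntermediateField.AdjoinSimple.algebraMap_gen, hfin] at this
      rw [← this]; rfl
    refine ⟨(minpoly Q α).natDegree, b, hpos, by omega, by rw [hb']; positivity, ?_⟩
    apply (algebraMap Q ℝ).injective
    rw [map_pow, hb', ← pow_mul, mul_comm, pow_mul, hαd]; simp
  choose m γ h1 h2 h3 h4 using key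
  have : Algebra.EssFiniteType ℚ Q := IntermediateField.essFiniteType_iff.2 hfg
  exact aux_main Q (algebraMap Q ℝ) d m γ h1 h2 h3 h4
end

section
/- Let L ⊆ ℂ be a finite Galois extension of ℚ and let a ∈ ℂ be algebraic over ℚ. Let q(X) ∈ L[X] be the minimal polynomial of a over L, and let E be the subfield of L generated over ℚ by the coefficients of q. Then [ℚ(a) : ℚ] = deg(q) · [E : ℚ]. In particular, [L(a) : L] divides [ℚ(a) : ℚ], and the quotient [ℚ(a):ℚ]/[L(a):L] is at most [L : ℚ]. -/
set_option synthInstance.maxHeartbeats 1000000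
set_option maxHeartbeats 1000000
open Polynomial IntermediateField

lemma coeff_mem {F Ω : Type} [Field F] [CharZero F] [Field Ω] [Algebra F Ω] [IsAlgClosed Ω]
    (L : IntermediateField F Ω) [FiniteDimensional F L] [IsGalois F L]
    (a : Ω) (ha : IsAlgebraic F a) (i : ℕ) :
    ((minpoly L a).coeff i : Ω) ∈ (IntermediateField.adjoin F {a} : IntermediateField F Ω) := by
  set K : IntermediateField F Ω := IntermediateField.adjoin F {a} with hK
  have hLalg : ∀ l : L, IsAlgebraic K (l : Ω) := fun l =>
    ((isAlgebraic_algebraMap_iff (algebraMap L Ω).injective).2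
      (Algebra.IsAlgebraic.isAlgebraic (R := F) l)).tower_top K
  have : CharZero K := charZero_of_injective_algebraMap (algebraMap F K).injective
  let M := algebraicClosure K Ω
  have : IsAlgClosure K M := algebraicClosure.isAlgClosure K Ω
  have : IsGalois K M := IsAlgClosure.isGalois K M
  let j : L →ₐ[F] M :=
    { toFun := fun l => ⟨(l : Ω), (hLalg l).isIntegral⟩
      map_one' := rfl
      map_mul' := fun _ _ => rfl
      map_zero' := rfl
      map_add' := fun _ _ => rfl
      commutes' := fun _ => rfl }
  have hint : IsIntegral L a := (ha.isIntegral).tower_top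
  have haK : a ∈ K := mem_adjoin_simple_self F a
  have hfix : ∀ σ : M ≃ₐ[K] M, σ (j ((minpoly L a).coeff i)) = j ((minpoly L a).coeff i) := by
    intro σ
    let ψ : L →ₐ[F] Ω := ((M.val.restrictScalars F).comp ((σ : M →ₐ[K] M).restrictScalars F)).comp j
    let τ : L →ₐ[F] L := AlgHom.codRestrict ψ L.toSubalgebra (fun l => by
      have h1 : ψ.fieldRange = L := by
        have := AlgHom.fieldRange_of_normal (E := L) ψ
        exact this
      have : ψ l ∈ ψ.fieldRange := ⟨l, rfl⟩
      rw [h1] at this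
      exact this)
    have hτ : ∀ l : L, ((τ l : L) : Ω) = (σ (j l) : M) := fun l => rfl
    have hz : aeval a ((minpoly L a).map (τ : L →+* L)) = 0 := by
      have h0 := minpoly.aeval L a
      let a' : M := algebraMap K M ⟨a, haK⟩
      have h1 : eval₂ (j : L →+* M) a' (minpoly L a) = 0 := by
        apply (algebraMap M Ω).injective
        rw [hom_eval₂, map_zero]
        exact h0
      have h2 := congrArg (fun z => algebraMap M Ω (σ z)) h1
      simp only [map_zero] at h2
      have h3 : σ (eval₂ (j : L →+* M) a' (minpoly L a)) =
        eval₂ (((σ : M →ₐ[K] M) : M →+* M).comp (j : L →+* M)) (σ a') (minpoly L a) :=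
        hom_eval₂ _ _ ((σ : M →ₐ[K] M) : M →+* M) _
      rw [h3, hom_eval₂, σ.commutes] at h2
      rw [aeval_def, eval₂_map]
      exact h2
    have hm := minpoly.monic hint
    have heq : (minpoly L a).map (τ : L →+* L) = minpoly L a :=
      (eq_of_monic_of_dvd_of_natDegree_le hm (hm.map _) (minpoly.dvd L a hz)
        (by rw [natDegree_map]))
    have hc := congrArg (fun p => p.coeff i) heq
    simp only [coeff_map] at hc
    apply Subtype.ext
    have := hτ ((minpoly L a).coeff i)
    rw [← this]
    exact congrArg Subtype.val hc
  have := (InfiniteGalois.mem_bot_iff_fixed (k := K) (K := M) (j ((minpoly L a).coeff i))).2 hfix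
  obtain ⟨y, hy⟩ := IntermediateField.mem_bot.1 this
  have h := congrArg Subtype.val hy
  have h' : (y : Ω) = ((minpoly L a).coeff i : Ω) := h
  rw [← h']
  exact y.2

theorem gen {F Ω : Type} [Field F] [CharZero F] [Field Ω] [Algebra F Ω] [IsAlgClosed Ω]
    (L : IntermediateField F Ω) [FiniteDimensional F L] [IsGalois F L]
    (a : Ω) (ha : IsAlgebraic F a) :
    Module.finrank F (IntermediateField.adjoin F {a} : IntermediateField F Ω) =
      (minpoly L a).natDegree *
        Module.finrank F (IntermediateField.adjoin F (Set.range (minpoly L a).coeff) :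
          IntermediateField F L) ∧
    Module.finrank L (IntermediateField.adjoin L {a} : IntermediateField L Ω) ∣
      Module.finrank F (IntermediateField.adjoin F {a} : IntermediateField F Ω) ∧
    Module.finrank F (IntermediateField.adjoin F {a} : IntermediateField F Ω) /
      Module.finrank L (IntermediateField.adjoin L {a} : IntermediateField L Ω) ≤
      Module.finrank F L := by
  have hint : IsIntegral L a := (ha.isIntegral).tower_top
  have hdeg := IntermediateField.adjoin.finrank hint
  have key : Module.finrank F (IntermediateField.adjoin F {a} : IntermediateField F Ω) =
      (minpoly L a).natDegree *
        Module.finrank F (IntermediateField.adjoin F (Set.range (minpoly L a).coeff) :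
          IntermediateField F L) := by
    set E : IntermediateField F L :=
      IntermediateField.adjoin F (Set.range (minpoly L a).coeff) with hE
    have hintE : IsIntegral E a := (ha.isIntegral).tower_top
    have hEK : ∀ x : L, x ∈ E → (x : Ω) ∈
        (IntermediateField.adjoin F {a} : IntermediateField F Ω) := by
      have : E ≤ (IntermediateField.adjoin F {a} : IntermediateField F Ω).comap L.val := by
        rw [hE, IntermediateField.adjoin_le_iff]
        rintro _ ⟨i, rfl⟩
        exact coeff_mem L a ha i
      exact fun x hx => this hx
    have hres : (IntermediateField.adjoin E {a} : IntermediateField E Ω).restrictScalars F =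
        IntermediateField.adjoin F {a} := by
      apply le_antisymm
      · intro x hx
        replace hx : x ∈ (IntermediateField.adjoin E {a} : IntermediateField E Ω) := hx
        induction hx using IntermediateField.adjoin_induction with
        | mem x h => exact IntermediateField.subset_adjoin _ _ h
        | algebraMap x => exact hEK x.1 x.2
        | add x y hx hy h1 h2 => exact add_mem h1 h2
        | inv x hx h1 => exact inv_mem h1
        | mul x y hx hy h1 h2 => exact mul_mem h1 h2
      · rw [IntermediateField.adjoin_le_iff]
        exact IntermediateField.subset_adjoin E {a}
    have hfr : Module.finrank F (IntermediateField.adjoin E {a} : IntermediateField E Ω) =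
        Module.finrank F (IntermediateField.adjoin F {a} : IntermediateField F Ω) := by
      rw [← hres]; rfl
    have hd : (minpoly E a).natDegree = (minpoly L a).natDegree := by
      have hl : minpoly L a ∈ Polynomial.lifts (algebraMap E L) := by
        rw [Polynomial.lifts_iff_coeff_lifts]
        intro n
        exact ⟨⟨_, IntermediateField.subset_adjoin _ _ ⟨n, rfl⟩⟩, rfl⟩
      obtain ⟨p, hp, hpd, hpm⟩ := Polynomial.lifts_and_natDegree_eq_and_monic hl (minpoly.monic hint)
      apply le_antisymm
      · rw [← hpd]
        apply natDegree_le_of_dvd _ hpm.ne_zero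
        apply minpoly.dvd
        rw [← aeval_map_algebraMap L, hp, minpoly.aeval]
      · rw [← natDegree_map (algebraMap E L) (p := minpoly E a)]
        apply natDegree_le_of_dvd (minpoly.dvd_map_of_isScalarTower E L a)
        exact ((minpoly.monic hintE).map _).ne_zero
    rw [← hfr, ← hd, ← IntermediateField.adjoin.finrank hintE, mul_comm]
    exact (Module.finrank_mul_finrank F E _).symm
  refine ⟨key, ?_, ?_⟩
  · rw [hdeg, key]; exact dvd_mul_right _ _
  · rw [hdeg, key, Nat.mul_div_cancel_left _ (minpoly.natDegree_pos hint)]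
    exact Submodule.finrank_le (Subalgebra.toSubmodule (IntermediateField.adjoin F (Set.range (minpoly L a).coeff) : IntermediateField F L).toSubalgebra)

theorem gen2 {F Ω : Type} [Field F] [CharZero F] [Field Ω] [Algebra F Ω] [IsAlgClosed Ω]
    (L : IntermediateField F Ω) [FiniteDimensional F L]
    (A : Algebra F L) (hA : A = L.algebra') (hG : @IsGalois F _ L _ A)
    (a : Ω) (ha : IsAlgebraic F a) :
    Module.finrank F (IntermediateField.adjoin F {a} : IntermediateField F Ω) =
      (minpoly L a).natDegree *
        Module.finrank F (@IntermediateField.adjoin F _ L _ A (Set.range (minpoly L a).coeff)) ∧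
    Module.finrank L (IntermediateField.adjoin L {a} : IntermediateField L Ω) ∣
      Module.finrank F (IntermediateField.adjoin F {a} : IntermediateField F Ω) ∧
    Module.finrank F (IntermediateField.adjoin F {a} : IntermediateField F Ω) /
      Module.finrank L (IntermediateField.adjoin L {a} : IntermediateField L Ω) ≤
      Module.finrank F L := by
  subst hA
  exact gen L a ha

/-- Let `L ⊆ ℂ` be a finite Galois extension of `ℚ`, `a ∈ ℂ` algebraic
over `ℚ`, `q` the minimal polynomial of `a` over `L`, and `E ⊆ L` the subfield
generated over `ℚ` by the coefficients of `q`.  Then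
`[ℚ(a):ℚ] = deg q · [E:ℚ]`; in particular `[L(a):L] ∣ [ℚ(a):ℚ]` with quotient
at most `[L:ℚ]`. -/
theorem stmt_4 (L : IntermediateField ℚ ℂ) [FiniteDimensional ℚ L] [IsGalois ℚ L]
    (a : ℂ) (ha : IsAlgebraic ℚ a) :
    Module.finrank ℚ (IntermediateField.adjoin ℚ {a} : IntermediateField ℚ ℂ) =
      (minpoly L a).natDegree *
        Module.finrank ℚ (IntermediateField.adjoin ℚ (Set.range (minpoly L a).coeff) :
          IntermediateField ℚ L) ∧
    Module.finrank L (IntermediateField.adjoin L {a} : IntermediateField L ℂ) ∣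
      Module.finrank ℚ (IntermediateField.adjoin ℚ {a} : IntermediateField ℚ ℂ) ∧
    Module.finrank ℚ (IntermediateField.adjoin ℚ {a} : IntermediateField ℚ ℂ) /
      Module.finrank L (IntermediateField.adjoin L {a} : IntermediateField L ℂ) ≤
      Module.finrank ℚ L := by
  exact gen2 (F := ℚ) (Ω := ℂ) L _ (Subsingleton.elim _ _) inferInstance a ha
end

section
/- Let x ∈ ℝ be an algebraic number of degree 2 over ℚ, and let α = 2^(1/3) be the real cube root of 2. Then ℚ(x + α) = ℚ(x, α), and consequently x + α is an algebraic number of degree 6 over ℚ. -/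
set_option synthInstance.maxHeartbeats 1000000
set_option maxHeartbeats 1000000

/-- If `x ∈ ℝ` has degree `2` over `ℚ` and `α` is the real cube root
of `2` (i.e. `α > 0` and `α³ = 2`), then `ℚ(x + α) = ℚ(x, α)` and `x + α` has
degree `6` over `ℚ`. -/
theorem stmt_5 (x : ℝ)
    (hx : Module.finrank ℚ (IntermediateField.adjoin ℚ {x} : IntermediateField ℚ ℝ) = 2)
    (α : ℝ) (hα : 0 < α) (hα3 : α ^ 3 = 2) :
    (IntermediateField.adjoin ℚ {x + α} : IntermediateField ℚ ℝ) =
      IntermediateField.adjoin ℚ {x, α} ∧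
    Module.finrank ℚ (IntermediateField.adjoin ℚ {x + α} : IntermediateField ℚ ℝ) = 6 := by
  have hfd : FiniteDimensional ℚ (IntermediateField.adjoin ℚ {x} : IntermediateField ℚ ℝ) :=
    FiniteDimensional.of_finrank_pos (by omega)
  have hint : IsIntegral ℚ x := by
    have h := IsIntegral.of_finite ℚ (IntermediateField.AdjoinSimple.gen ℚ x)
    exact (IntermediateField.AdjoinSimple.isIntegral_gen ℚ x).1 h
  have hdeg : (minpoly ℚ x).natDegree = 2 := by
    rw [← IntermediateField.adjoin.finrank hint, hx]
  obtain ⟨p, q, hpq⟩ : ∃ p q : ℚ, x ^ 2 + p * x + q = 0 := by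
    refine ⟨(minpoly ℚ x).coeff 1, (minpoly ℚ x).coeff 0, ?_⟩
    have h := minpoly.aeval ℚ x
    have hm : (minpoly ℚ x).coeff 2 = 1 := by
      have := minpoly.monic hint
      rw [Polynomial.Monic, Polynomial.leadingCoeff, hdeg] at this
      exact this
    rw [Polynomial.aeval_eq_sum_range, hdeg] at h
    simp [Finset.sum_range_succ, hm, Algebra.smul_def] at h
    linarith
  have hs0 : x + p / 2 ≠ 0 := by
    intro h0
    have hxq : x = algebraMap ℚ ℝ (-p / 2) := by
      simp only [eq_ratCast]; push_cast; linarith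
    rw [hxq, minpoly.eq_X_sub_C] at hdeg
    simp at hdeg
  have hd : (x + p / 2) ^ 2 = ((p ^ 2 / 4 - q : ℚ) : ℝ) := by
    push_cast; linarith
  have heq : (IntermediateField.adjoin ℚ {x + α} : IntermediateField ℚ ℝ) =
      IntermediateField.adjoin ℚ {x, α} := by
    apply le_antisymm
    · rw [IntermediateField.adjoin_simple_le_iff]
      exact add_mem (IntermediateField.subset_adjoin ℚ _ (by simp))
        (IntermediateField.subset_adjoin ℚ _ (by simp))
    · set K := (IntermediateField.adjoin ℚ {x + α} : IntermediateField ℚ ℝ) with hK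
      have hb : x + α ∈ K := IntermediateField.mem_adjoin_simple_self ℚ _
      have hrat : ∀ r : ℚ, (r : ℝ) ∈ K := fun r => K.algebraMap_mem r
      have hxK : x ∈ K := by
        set d : ℚ := p ^ 2 / 4 - q with hdd
        have hden : 3 * (x + α + (p / 2 : ℚ)) ^ 2 + (d : ℝ) ≠ 0 := by
          rw [← hd]; positivity
        have hg : x + α + (p / 2 : ℚ) ∈ K := add_mem hb (hrat _)
        have key : x = ((x + α + (p / 2 : ℚ)) ^ 3 + (3 * d : ℚ) * (x + α + (p / 2 : ℚ)) - (2 : ℚ)) /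
            ((3 : ℚ) * (x + α + (p / 2 : ℚ)) ^ 2 + (d : ℝ)) - (p / 2 : ℚ) := by
          rw [eq_sub_iff_add_eq, eq_div_iff (by simpa using hden)]
          push_cast
          rw [← hd, ← hα3]
          ring
        rw [key]
        exact sub_mem (div_mem (sub_mem (add_mem (pow_mem hg 3) (mul_mem (hrat _) hg)) (hrat _))
          (add_mem (mul_mem (hrat _) (pow_mem hg 2)) (hrat _))) (hrat _)
      rw [IntermediateField.adjoin_le_iff]
      rintro y (rfl | rfl)
      · exact hxK
      · simpa using sub_mem hb hxK
  refine ⟨heq, ?_⟩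
  have hirr : Irreducible (Polynomial.X ^ 3 - Polynomial.C (2 : ℚ)) := by
    apply X_pow_sub_C_irreducible_of_prime Nat.prime_three
    intro b hb
    have hi : IsIntegral ℤ b := by
      refine IsIntegral.of_pow (n := 3) (by norm_num) ?_
      rw [hb]
      exact isIntegral_algebraMap (R := ℤ) (x := 2)
    obtain ⟨n, rfl⟩ := IsIntegrallyClosed.isIntegral_iff.1 hi
    have hn : n ^ 3 = 2 := by
      simp only [eq_intCast] at hb
      exact_mod_cast hb
    have h1 : 0 < n := by by_contra h; nlinarith [sq_nonneg n]
    have h2 : n < 2 := by by_contra h; nlinarith [sq_nonneg n]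
    have : n = 1 := by omega
    subst this
    norm_num at hn
  have hmon : (Polynomial.X ^ 3 - Polynomial.C (2 : ℚ)).Monic :=
    Polynomial.monic_X_pow_sub_C _ (by norm_num)
  have hroot : Polynomial.aeval α (Polynomial.X ^ 3 - Polynomial.C (2 : ℚ)) = 0 := by
    simp [hα3]
  have hαint : IsIntegral ℚ α := ⟨_, hmon, by simpa [Polynomial.aeval_def] using hroot⟩
  have hα' : Module.finrank ℚ (IntermediateField.adjoin ℚ {α} : IntermediateField ℚ ℝ) = 3 := by
    rw [IntermediateField.adjoin.finrank hαint,
      ← minpoly.eq_of_irreducible_of_monic hirr hroot hmon, Polynomial.natDegree_X_pow_sub_C]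
  have hsup : (IntermediateField.adjoin ℚ {x, α} : IntermediateField ℚ ℝ) =
      IntermediateField.adjoin ℚ {x} ⊔ IntermediateField.adjoin ℚ {α} := by
    rw [← IntermediateField.adjoin_union]; rfl
  rw [heq, hsup]
  have hld := IntermediateField.LinearDisjoint.of_finrank_coprime
    (A := IntermediateField.adjoin ℚ {x}) (L := (IntermediateField.adjoin ℚ {α} : IntermediateField ℚ ℝ))
    (by rw [hx, hα']; norm_num)
  rw [hld.finrank_sup, hx, hα']
end

section
/- Let p and q be positive, relatively prime integers, and let x, z ∈ ℝ be algebraic numbers over ℚ with [ℚ(x) : ℚ] = p and [ℚ(z) : ℚ] = q. Then ℚ(x + z) = ℚ(x, z), and consequently x + z is an algebraic number of degree pq over ℚ. -/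
set_option synthInstance.maxHeartbeats 1000000
set_option maxHeartbeats 1000000
open IntermediateField Polynomial in
/-- Coprime degrees: the stabiliser of `z` acts transitively on conjugates of `x`. -/
theorem aux_conj {F E : Type*} [Field F] [CharZero F] [Field E] [Algebra F E] [FiniteDimensional F E] [IsGalois F E]
    (x z : E) (h : Nat.Coprime (minpoly F x).natDegree (minpoly F z).natDegree)
    (σ : E ≃ₐ[F] E) : ∃ τ : E ≃ₐ[F] E, τ x = σ x ∧ τ z = z := by
  have hix : IsIntegral F x := Algebra.IsIntegral.isIntegral x
  have hiz : IsIntegral F z := Algebra.IsIntegral.isIntegral z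
  have hix' : IsIntegral F⟮z⟯ x := hix.tower_top
  have hdiv : (minpoly F x).natDegree ∣ (minpoly F⟮z⟯ x).natDegree := by
    refine h.dvd_of_dvd_mul_left ?_
    rw [← adjoin.finrank hiz, ← adjoin.finrank hix', Module.finrank_mul_finrank]
    let M : IntermediateField F E := (F⟮z⟯⟮x⟯).restrictScalars F
    have hxM : x ∈ M := mem_adjoin_simple_self F⟮z⟯ x
    have hd := minpoly.degree_dvd (K := F) (Algebra.IsIntegral.isIntegral (R := F) (⟨x, hxM⟩ : M))
    have h2 : minpoly F (⟨x, hxM⟩ : M) = minpoly F x :=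
      (minpoly.algHom_eq M.val M.val.injective _).symm
    rw [h2] at hd
    exact hd
  have hmin : (minpoly F x).map (algebraMap F F⟮z⟯) = minpoly F⟮z⟯ x := by
    refine Polynomial.eq_of_monic_of_dvd_of_natDegree_le (minpoly.monic hix')
      ((minpoly.monic hix).map _) (minpoly.dvd_map_of_isScalarTower F F⟮z⟯ x) ?_
    rw [natDegree_map]
    exact Nat.le_of_dvd (minpoly.natDegree_pos hix') hdiv
  have hroot : aeval (σ x) (minpoly F⟮z⟯ x) = 0 := by
    rw [← hmin, aeval_map_algebraMap, ← AlgEquiv.coe_algHom, aeval_algHom_apply, minpoly.aeval, map_zero]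
  have hc : IsConjRoot F⟮z⟯ x (σ x) := isConjRoot_of_aeval_eq_zero hix' hroot
  rw [isConjRoot_iff_exists_algEquiv] at hc
  obtain ⟨τ, hτ⟩ := hc
  refine ⟨(τ.restrictScalars F).symm, ?_, ?_⟩
  · rw [AlgEquiv.symm_apply_eq, AlgEquiv.restrictScalars_apply, hτ]
  · rw [AlgEquiv.symm_apply_eq, AlgEquiv.restrictScalars_apply]
    exact (τ.commutes (AdjoinSimple.gen F z)).symm

open ComplexConjugate in
/-- The Galois-invariant Hermitian form. -/
theorem aux_fix {F E : Type*} [Field F] [CharZero F] [Field E] [Algebra F E] [FiniteDimensional F E] [IsGalois F E]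
    (ι : E →+* ℂ)
    (x z : E) (h : Nat.Coprime (minpoly F x).natDegree (minpoly F z).natDegree)
    (σ : E ≃ₐ[F] E) (hσ : σ (x + z) = x + z) : σ x = x := by
  obtain ⟨τ, hτx, hτz⟩ := aux_conj x z h σ
  obtain ⟨ρ, hρz, hρx⟩ := aux_conj z x h.symm σ
  let B : E → E → ℂ := fun u v => ∑ g : E ≃ₐ[F] E, ι (g u) * conj (ι (g v))
  have inv : ∀ (s : E ≃ₐ[F] E) u v, B (s u) (s v) = B u v := fun s u v =>
    Fintype.sum_equiv (Equiv.mulRight s) _ _ (fun g => rfl)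
  have e1 : B (σ x) z = B x z := by rw [← hτx]; conv_lhs => rw [← hτz]
                                    exact inv τ x z
  have e2 : B x (σ z) = B x z := by rw [← hρz]; conv_lhs => rw [← hρx]
                                    exact inv ρ x z
  have e3 := inv σ x z
  have hw : σ x - x = z - σ z := by rw [map_add] at hσ; linear_combination hσ
  have hB : B (σ x - x) (z - σ z) = B (σ x) z - B (σ x) (σ z) - B x z + B x (σ z) := by
    simp only [B, map_sub, ← Finset.sum_sub_distrib, ← Finset.sum_add_distrib]
    exact Finset.sum_congr rfl fun g _ => by ring
  rw [← hw, e1, e2, e3] at hB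
  have h0 : ∑ g : E ≃ₐ[F] E, Complex.normSq (ι (g (σ x - x))) = 0 := by
    have : B (σ x - x) (σ x - x) = 0 := by rw [hB]; ring
    simp only [B, Complex.mul_conj] at this
    exact_mod_cast this
  rw [Finset.sum_eq_zero_iff_of_nonneg (fun _ _ => Complex.normSq_nonneg _)] at h0
  have := h0 1 (Finset.mem_univ _)
  rw [Complex.normSq_eq_zero, map_eq_zero] at this
  exact sub_eq_zero.mp this

open IntermediateField in
theorem aux_mem {F E : Type*} [Field F] [CharZero F] [Field E] [Algebra F E] [FiniteDimensional F E] [IsGalois F E]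
    (ι : E →+* ℂ)
    (x z : E) (h : Nat.Coprime (minpoly F x).natDegree (minpoly F z).natDegree) :
    x ∈ F⟮x + z⟯ := by
  rw [← IsGalois.fixedField_fixingSubgroup F⟮x + z⟯, mem_fixedField_iff]
  intro σ hσ
  rw [IntermediateField.mem_fixingSubgroup_iff] at hσ
  exact aux_fix ι x z h σ (hσ _ (mem_adjoin_simple_self F _))

open IntermediateField in
theorem aux_real {F R : Type*} [Field F] [CharZero F] [Field R] [Algebra F R] [Algebra F ℂ]
    (c : R →ₐ[F] ℂ) (x z : R) (hx : IsIntegral F x) (hz : IsIntegral F z)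
    (h : Nat.Coprime (minpoly F x).natDegree (minpoly F z).natDegree) :
    x ∈ F⟮x + z⟯ := by
  let P : Polynomial F := minpoly F x * minpoly F z
  have hP : P ≠ 0 := mul_ne_zero (minpoly.ne_zero hx) (minpoly.ne_zero hz)
  let E : IntermediateField F ℂ := adjoin F (P.rootSet ℂ)
  have hs : P.IsSplittingField F E :=
    adjoin_rootSet_isSplittingField (IsAlgClosed.splits _)
  have : FiniteDimensional F E := Polynomial.IsSplittingField.finiteDimensional E P
  have : Normal F E := Normal.of_isSplittingField P
  have : IsGalois F E := ⟨⟩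
  have hxE : c x ∈ E := subset_adjoin _ _ (by
    rw [Polynomial.mem_rootSet]
    exact ⟨hP, by rw [Polynomial.aeval_algHom_apply]; simp [P]⟩)
  have hzE : c z ∈ E := subset_adjoin _ _ (by
    rw [Polynomial.mem_rootSet]
    exact ⟨hP, by rw [Polynomial.aeval_algHom_apply]; simp [P]⟩)
  have mx : minpoly F (⟨c x, hxE⟩ : E) = minpoly F x := by
    rw [← minpoly.algHom_eq c c.injective, ← minpoly.algHom_eq E.val E.val.injective]; rfl
  have mz : minpoly F (⟨c z, hzE⟩ : E) = minpoly F z := by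
    rw [← minpoly.algHom_eq c c.injective, ← minpoly.algHom_eq E.val E.val.injective]; rfl
  have key := aux_mem (algebraMap E ℂ) (⟨c x, hxE⟩ : E) ⟨c z, hzE⟩ (by rwa [mx, mz])
  have k2 : c x ∈ (F⟮(⟨c x, hxE⟩ : E) + ⟨c z, hzE⟩⟯).map E.val := ⟨_, key, rfl⟩
  rw [adjoin_map, Set.image_singleton] at k2
  have k3 : c x ∈ (F⟮x + z⟯).map c := by
    rw [adjoin_map, Set.image_singleton, map_add]; exact k2
  obtain ⟨y, hy, hyx⟩ := k3
  have e : y = x := c.injective hyx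
  rw [e] at hy
  exact hy

/-- If `p, q` are positive coprime integers and `x, z ∈ ℝ` are
algebraic with `[ℚ(x):ℚ] = p` and `[ℚ(z):ℚ] = q`, then `ℚ(x + z) = ℚ(x, z)` and
`x + z` has degree `pq` over `ℚ`. -/
theorem stmt_6 (p q : ℕ) (hp : 0 < p) (hq : 0 < q) (hpq : Nat.Coprime p q)
    (x z : ℝ)
    (hx : Module.finrank ℚ (IntermediateField.adjoin ℚ {x} : IntermediateField ℚ ℝ) = p)
    (hz : Module.finrank ℚ (IntermediateField.adjoin ℚ {z} : IntermediateField ℚ ℝ) = q) :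
    (IntermediateField.adjoin ℚ {x + z} : IntermediateField ℚ ℝ) =
      IntermediateField.adjoin ℚ {x, z} ∧
    Module.finrank ℚ (IntermediateField.adjoin ℚ {x + z} : IntermediateField ℚ ℝ) = p * q := by

  have ix : IsIntegral ℚ x := by
    have : FiniteDimensional ℚ (IntermediateField.adjoin ℚ {x} : IntermediateField ℚ ℝ) :=
      FiniteDimensional.of_finrank_pos (by rw [hx]; assumption)
    exact IntermediateField.isIntegral_iff.1 (Algebra.IsIntegral.isIntegral (R := ℚ)
      (IntermediateField.AdjoinSimple.gen ℚ x))
  have iz : IsIntegral ℚ z := by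
    have : FiniteDimensional ℚ (IntermediateField.adjoin ℚ {z} : IntermediateField ℚ ℝ) :=
      FiniteDimensional.of_finrank_pos (by rw [hz]; assumption)
    exact IntermediateField.isIntegral_iff.1 (Algebra.IsIntegral.isIntegral (R := ℚ)
      (IntermediateField.AdjoinSimple.gen ℚ z))
  have hc : Nat.Coprime (minpoly ℚ x).natDegree (minpoly ℚ z).natDegree := by
    rwa [← IntermediateField.adjoin.finrank ix, ← IntermediateField.adjoin.finrank iz, hx, hz]
  have hxm := aux_real Complex.ofRealHom.toRatAlgHom x z ix iz hc
  have heq : (IntermediateField.adjoin ℚ {x + z} : IntermediateField ℚ ℝ) =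
      IntermediateField.adjoin ℚ {x, z} := by
    apply le_antisymm
    · rw [IntermediateField.adjoin_simple_le_iff]
      exact add_mem (IntermediateField.subset_adjoin _ _ (by simp))
        (IntermediateField.subset_adjoin _ _ (by simp))
    · rw [IntermediateField.adjoin_le_iff]
      rintro y (rfl | rfl)
      · exact hxm
      · have := sub_mem (IntermediateField.mem_adjoin_simple_self ℚ (x + y)) hxm
        rwa [add_sub_cancel_left] at this
  refine ⟨heq, ?_⟩
  have hld : (IntermediateField.adjoin ℚ {x} : IntermediateField ℚ ℝ).LinearDisjoint
      (IntermediateField.adjoin ℚ {z} : IntermediateField ℚ ℝ) :=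
    IntermediateField.LinearDisjoint.of_finrank_coprime (by rwa [hx, hz])
  rw [heq, ← hx, ← hz, ← hld.finrank_sup, ← IntermediateField.adjoin_union]
  rfl
end

section
/- Let p ≥ 1 and let h(X) ∈ ℚ[X] be an irreducible polynomial of degree p. Let K₀, K₁, …, K_n with n = 2^p − 2 be subfields of ℝ (thus 2^p − 1 subfields in total) such that K_i ∩ K_j = ℚ for all i ≠ j. Then there exists an index i ≤ n such that h(X) remains irreducible as a polynomial in K_i[X]. -/
open Polynomial in
lemma aux_factor (h : ℚ[X]) (hirr : Irreducible h) (K : Subfield ℝ)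
    (hn : ¬ Irreducible (h.map (algebraMap ℚ K))) :
    ∃ G : ℝ[X], G.Monic ∧ G ∣ h.map (algebraMap ℚ ℝ) ∧ 0 < G.natDegree ∧
      G.natDegree < h.natDegree ∧ ∀ n, G.coeff n ∈ K := by
  have h0 : h ≠ 0 := hirr.ne_zero
  have hd : 0 < h.natDegree := hirr.natDegree_pos
  have hu : ¬ IsUnit (h.map (algebraMap ℚ K)) := by
    intro hu
    have := natDegree_eq_zero_of_isUnit hu
    rw [natDegree_map] at this
    omega
  obtain ⟨g, hgm, hg, hgd⟩ := exists_monic_irreducible_factor _ hu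
  have hm0 : h.map (algebraMap ℚ K) ≠ 0 := (Polynomial.map_ne_zero_iff (algebraMap ℚ K).injective).2 h0
  have hle := natDegree_le_of_dvd hgd hm0
  rw [natDegree_map] at hle
  refine ⟨g.map K.subtype, hgm.map _, ?_, ?_, ?_, ?_⟩
  · have := map_dvd K.subtype hgd
    rw [Polynomial.map_map] at this
    convert this using 2
    exact Subsingleton.elim _ _
  · rw [natDegree_map]; exact hg.natDegree_pos
  · rw [natDegree_map]
    refine lt_of_le_of_ne hle fun he => hn ?_
    obtain ⟨c, hc⟩ := hgd
    have hc0 : c ≠ 0 := by rintro rfl; simp at hc; exact h0 hc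
    have hcd : c.natDegree = 0 := by
      have := congrArg natDegree hc
      rw [natDegree_map, natDegree_mul hgm.ne_zero hc0] at this
      omega
    have hcu : IsUnit c := by
      rw [eq_C_of_natDegree_eq_zero hcd] at hc0 ⊢
      refine isUnit_C.2 (isUnit_iff_ne_zero.2 ?_)
      rintro h; simp [h] at hc0
    rw [hc]
    exact (irreducible_mul_isUnit hcu).2 hg
  · intro n
    rw [coeff_map]
    exact (g.coeff n).2

open Polynomial in
theorem stmt_7 (p : ℕ) (hp : 1 ≤ p) (h : Polynomial ℚ)
    (hirr : Irreducible h) (hdeg : h.natDegree = p)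
    (K : Fin (2 ^ p - 1) → Subfield ℝ)
    (hK : ∀ i j, i ≠ j → K i ⊓ K j = ⊥) :
    ∃ i, Irreducible (h.map (algebraMap ℚ (K i))) := by
  classical
  by_contra hcon
  push Not at hcon
  choose G hGm hGd hG0 hG1 hGK using fun i => aux_factor h hirr (K i) (hcon i)
  have h0 : h ≠ 0 := hirr.ne_zero
  set H : ℂ[X] := h.map (algebraMap ℚ ℂ) with hH
  have hH0 : H ≠ 0 := (Polynomial.map_ne_zero_iff (algebraMap ℚ ℂ).injective).2 h0
  have hnd : H.roots.Nodup := nodup_roots (hirr.separable.map)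
  have hHc : H.roots.toFinset.card ≤ p := by
    refine (Multiset.toFinset_card_le _).trans ((card_roots' _).trans ?_)
    rw [hH, natDegree_map, hdeg]
  have hHc' : H.roots.toFinset.card = p := by
    rw [Multiset.toFinset_card_of_nodup hnd, (IsAlgClosed.splits H).natDegree_eq_card_roots.symm,
      hH, natDegree_map, hdeg]
  let M := fun i => (G i).map (algebraMap ℝ ℂ)
  have hMm : ∀ i, (M i).Monic := fun i => (hGm i).map _
  have hMd : ∀ i, M i ∣ H := by
    intro i
    have := map_dvd (algebraMap ℝ ℂ) (hGd i)
    rw [Polynomial.map_map] at this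
    convert this using 2
    exact Subsingleton.elim _ _
  have hMr : ∀ i, (M i).roots ≤ H.roots := fun i => roots.le_of_dvd hH0 (hMd i)
  have hMn : ∀ i, (M i).roots.Nodup := fun i => Multiset.nodup_of_le (hMr i) hnd
  have hMc : ∀ i, (M i).roots.toFinset.card = (G i).natDegree := by
    intro i
    rw [Multiset.toFinset_card_of_nodup (hMn i),
      (IsAlgClosed.splits (M i)).natDegree_eq_card_roots.symm, natDegree_map]
  let R := H.roots.toFinset
  let T := (R.powerset.erase ∅).erase R
  have hT : T.card = 2 ^ p - 1 - 1 := by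
    rw [Finset.card_erase_of_mem, Finset.card_erase_of_mem, Finset.card_powerset, hHc']
    · simp
    · simp only [Finset.mem_erase, Finset.mem_powerset, subset_refl, and_true]
      intro he
      rw [← Finset.card_eq_zero, hHc'] at he
      omega
  have h2 : 2 ≤ 2 ^ p := by
    calc 2 = 2 ^ 1 := rfl
      _ ≤ 2 ^ p := Nat.pow_le_pow_right (by norm_num) hp
  obtain ⟨i, -, j, -, hij, he⟩ := Finset.exists_ne_map_eq_of_card_lt_of_maps_to
    (s := (Finset.univ : Finset (Fin (2 ^ p - 1)))) (t := T)
    (f := fun i => (M i).roots.toFinset)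
    (by rw [hT, Finset.card_univ, Fintype.card_fin]; omega)
    (by
      intro i _
      have := hMc i
      have a := hG0 i
      have b := hG1 i
      refine Finset.mem_coe.2 (Finset.mem_erase.2 ⟨?_, Finset.mem_erase.2 ⟨?_, Finset.mem_powerset.2 ?_⟩⟩)
      · intro hh
        beta_reduce at hh
        rw [hh, hHc'] at this
        omega
      · intro hh
        beta_reduce at hh
        rw [hh, Finset.card_empty] at this
        omega
      · exact Multiset.toFinset_subset.2 (Multiset.subset_of_le (hMr i)))
  have hr : (M i).roots = (M j).roots := by
    have := congrArg Finset.val he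
    simpa [Multiset.toFinset_val, (hMn i).dedup, (hMn j).dedup] using this
  have hMM : M i = M j := by
    rw [(IsAlgClosed.splits (M i)).eq_prod_roots_of_monic (hMm i),
      (IsAlgClosed.splits (M j)).eq_prod_roots_of_monic (hMm j), hr]
  have hGG : G i = G j := map_injective _ (algebraMap ℝ ℂ).injective hMM
  have hl : G i ∈ lifts (algebraMap ℚ ℝ) := by
    rw [lifts_iff_coeff_lifts]
    intro n
    have : (G i).coeff n ∈ K i ⊓ K j := ⟨hGK i n, hGG ▸ hGK j n⟩
    rw [hK i j hij, Subfield.bot_eq_of_charZero] at this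
    exact this
  obtain ⟨q, hq⟩ := (mem_lifts _).1 hl
  have hqd : q ∣ h := by
    have := hGd i
    rw [← hq] at this
    exact (map_dvd_map' _).1 this
  have hqn : q.natDegree = (G i).natDegree := by rw [← hq, natDegree_map]
  have a := hG0 i
  have b := hG1 i
  rcases hirr.dvd_iff.1 hqd with hu | hu
  · have := natDegree_eq_zero_of_isUnit hu
    omega
  · have := natDegree_eq_of_degree_eq (degree_eq_degree_of_associated hu)
    omega
end

section
/- Let 𝔠 ⊆ [0,1] be the middle-thirds Cantor set. For every infinite cardinal κ with κ < 2^ℵ₀, there do not exist open sets U, V ⊆ ℝ such that the complement ℝ ∖ (U ∪ V) has cardinality at most κ, U ∩ 𝔠 has cardinality at most κ, and V ∩ (ℝ ∖ 𝔠) has cardinality at most κ. That is, the Cantor set has local bicardinality 2^ℵ₀. -/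
lemma cantor_halves {x : ℝ} (hx : x ∈ cantorSet) :
    (3 * x ∈ cantorSet ∧ x ≤ 1 / 3) ∨ (3 * x - 2 ∈ cantorSet ∧ 2 / 3 ≤ x) := by
  rw [cantorSet_eq_union_halves] at hx
  rcases hx with ⟨y, hy, rfl⟩ | ⟨y, hy, rfl⟩
  · left
    have h := cantorSet_subset_unitInterval hy
    have e : 3 * (y / 3) = y := by ring
    refine ⟨?_, ?_⟩
    · simpa only [e] using hy
    · have := h.2
      simp only
      linarith
  · right
    have h := cantorSet_subset_unitInterval hy
    have e : 3 * ((2 + y) / 3) - 2 = y := by ring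
    refine ⟨?_, ?_⟩
    · simpa only [e] using hy
    · have := h.1
      simp only
      linarith

lemma cantor_interval (n : ℕ) : ∀ a b : ℝ, a ≤ b → Set.Icc a b ⊆ cantorSet →
    b - a ≤ (1 / 3) ^ n := by
  induction n with
  | zero =>
    intro a b hab h
    have h1 := cantorSet_subset_unitInterval (h (Set.left_mem_Icc.2 hab))
    have h2 := cantorSet_subset_unitInterval (h (Set.right_mem_Icc.2 hab))
    have := h1.1
    have := h2.2
    simp only [pow_zero]
    linarith
  | succ n ih =>
    intro a b hab h
    have key : b < 1 / 2 ∨ 1 / 2 < a := by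
      by_contra! hc
      rcases cantor_halves (h ⟨hc.2, hc.1⟩) with h1 | h1
      · linarith [h1.2]
      · linarith [h1.2]
    rw [pow_succ]
    rcases key with hb | ha
    · have := ih (3 * a) (3 * b) (by linarith) (by
        intro x hx
        have hm : x / 3 ∈ Set.Icc a b := ⟨by linarith [hx.1], by linarith [hx.2]⟩
        rcases cantor_halves (h hm) with h1 | h1
        · have e : 3 * (x / 3) = x := by ring
          simpa only [e] using h1.1
        · linarith [h1.2, hm.2])
      linarith
    · have := ih (3 * a - 2) (3 * b - 2) (by linarith) (by
        intro x hx
        have hm : (x + 2) / 3 ∈ Set.Icc a b := ⟨by linarith [hx.1], by linarith [hx.2]⟩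
        rcases cantor_halves (h hm) with h1 | h1
        · linarith [h1.2, hm.1]
        · have e : 3 * ((x + 2) / 3) - 2 = x := by ring
          simpa only [e] using h1.1)
      linarith

lemma cantor_open_empty {V : Set ℝ} (hV : IsOpen V) (h : V ⊆ cantorSet) : V = ∅ := by
  by_contra hne
  obtain ⟨x, hx⟩ := Set.nonempty_iff_ne_empty.2 hne
  obtain ⟨ε, hε, hb⟩ := Metric.isOpen_iff.1 hV x hx
  obtain ⟨n, hn⟩ := exists_pow_lt_of_lt_one (half_pos hε) (show (1 / 3 : ℝ) < 1 by norm_num)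
  have := cantor_interval n x (x + ε / 2) (by linarith) (by
    intro y hy
    apply h
    apply hb
    rw [Metric.mem_ball, Real.dist_eq, abs_lt]
    constructor <;> linarith [hy.1, hy.2])
  linarith

/-- The middle-thirds Cantor set `cantorSet` has local bicardinality
`2^ℵ₀`: for no infinite cardinal `κ < 2^ℵ₀` are there open sets `U, V ⊆ ℝ` with
`|ℝ ∖ (U ∪ V)| ≤ κ`, `|U ∩ 𝔠| ≤ κ`, and `|V ∩ 𝔠ᶜ| ≤ κ`. -/
theorem stmt_12 (κ : Cardinal) (hκ : Cardinal.aleph0 ≤ κ) (hκc : κ < 2 ^ Cardinal.aleph0) :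
    ¬ ∃ U V : Set ℝ, IsOpen U ∧ IsOpen V ∧
      Cardinal.mk ((U ∪ V)ᶜ : Set ℝ) ≤ κ ∧
      Cardinal.mk (U ∩ cantorSet : Set ℝ) ≤ κ ∧
      Cardinal.mk (V ∩ cantorSetᶜ : Set ℝ) ≤ κ := by
  rintro ⟨U, V, hU, hV, h1, h2, h3⟩
  have hVC : V ⊆ cantorSet := by
    intro x hx
    by_contra hxc
    have := continuum_le_cardinal_of_isOpen ℝ
      (hV.inter isClosed_cantorSet.isOpen_compl) ⟨x, hx, hxc⟩
    rw [← Cardinal.two_power_aleph0] at this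
    exact absurd (this.trans h3) (not_le.2 hκc)
  have hV0 := cantor_open_empty hV hVC
  subst hV0
  have hsub : cantorSet ⊆ (U ∩ cantorSet) ∪ (U ∪ ∅)ᶜ := by
    intro x hx
    by_cases hxU : x ∈ U
    · exact Or.inl ⟨hxU, hx⟩
    · right
      simpa using hxU
  have hle : Cardinal.mk cantorSet ≤ κ :=
    (Cardinal.mk_le_mk_of_subset hsub).trans ((Cardinal.mk_union_le _ _).trans
      (Cardinal.add_le_of_le hκ h2 h1))
  have hc : Cardinal.mk cantorSet = 2 ^ Cardinal.aleph0 := by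
    rw [Cardinal.mk_congr cantorSetEquivNatToBool]
    simp
  rw [hc] at hle
  exact absurd hle (not_le.2 hκc)
end

section
/- Let 𝔠 ⊆ [0,1] be the middle-thirds Cantor set. Then 𝔠 generates ℝ as a ring: the subring of ℝ generated by 𝔠 is all of ℝ. In particular, 𝔠 generates ℝ as a field. -/
/-- Every `2 * y` with `y ∈ [0,1)` is a sum of two elements of the Cantor set. -/
lemma two_mul_eq_add_cantor (y : ℝ) (hy : y ∈ Set.Ico (0 : ℝ) 1) :
    ∃ u ∈ cantorSet, ∃ v ∈ cantorSet, 2 * y = u + v := by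
  have hd := Real.ofDigits_digits (b := 3) (by norm_num) hy
  set d := Real.digits y 3 with hdd
  refine ⟨_, ofDigits_zero_two_sequence_mem_cantorSet
      (a := fun i => if d i = 0 then 0 else 2) ?_, _,
    ofDigits_zero_two_sequence_mem_cantorSet (a := fun i => if d i = 2 then 2 else 0) ?_, ?_⟩
  · intro n
    split_ifs <;> decide
  · intro n
    split_ifs <;> decide
  · rw [← hd]
    unfold Real.ofDigits
    rw [← tsum_mul_left, ← Real.summable_ofDigitsTerm.tsum_add Real.summable_ofDigitsTerm]
    congr 1
    ext n
    unfold Real.ofDigitsTerm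
    beta_reduce
    generalize d n = k
    rw [← add_mul, ← mul_assoc]
    congr 1
    fin_cases k
    · norm_num
    · norm_num
    · change (2 : ℝ) * ((2 : ℕ) : ℝ) = ((2 : ℕ) : ℝ) + ((2 : ℕ) : ℝ)
      norm_num

lemma mem_closure_cantor (x : ℝ) : x ∈ Subring.closure cantorSet := by
  obtain ⟨u, hu, v, hv, h⟩ := two_mul_eq_add_cantor (Int.fract x / 2)
    ⟨by have := Int.fract_nonneg x; linarith, by have := Int.fract_lt_one x; linarith⟩
  have hx : x = (⌊x⌋ : ℝ) + (u + v) := by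
    rw [← h]
    have := Int.floor_add_fract x
    linarith
  rw [hx]
  exact add_mem (intCast_mem _ _)
    (add_mem (Subring.subset_closure hu) (Subring.subset_closure hv))

/-- The middle-thirds Cantor set generates `ℝ` as a ring; in
particular it generates `ℝ` as a field. -/
theorem stmt_14 :
    Subring.closure cantorSet = (⊤ : Subring ℝ) ∧
    Subfield.closure cantorSet = (⊤ : Subfield ℝ) := by
  refine ⟨eq_top_iff.2 fun x _ => mem_closure_cantor x, eq_top_iff.2 fun x _ => ?_⟩
  exact (Subring.closure_le (t := (Subfield.closure cantorSet).toSubring)).2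
    Subfield.subset_closure (mem_closure_cantor x)
end

section
/- Let 𝔠 ⊆ [0,1] be the middle-thirds Cantor set. Then every x ∈ [0,1] can be written in the form x = c₂ + c₁/2 with c₁, c₂ ∈ 𝔠. -/
/-- Every `x ∈ [0,1]` can be written as `x = c₂ + c₁/2` with
`c₁, c₂` in the middle-thirds Cantor set. -/
theorem stmt_15 (x : ℝ) (hx : x ∈ Set.Icc (0 : ℝ) 1) :
    ∃ c₁ ∈ cantorSet, ∃ c₂ ∈ cantorSet, x = c₂ + c₁ / 2 := by
  obtain ⟨d, -, rfl⟩ := Real.ofDigits_SurjOn (b := 3) (by norm_num) hx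
  refine ⟨Real.ofDigits (fun i => if d i = 1 then (2 : Fin 3) else 0),
    ofDigits_zero_two_sequence_mem_cantorSet ?_,
    Real.ofDigits (fun i => if d i = 2 then (2 : Fin 3) else 0),
    ofDigits_zero_two_sequence_mem_cantorSet ?_, ?_⟩
  · intro n
    split_ifs <;> decide
  · intro n
    split_ifs <;> decide
  · unfold Real.ofDigits
    rw [← tsum_div_const, ← Summable.tsum_add Real.summable_ofDigitsTerm
      (Real.summable_ofDigitsTerm.div_const 2)]
    refine tsum_congr fun n => ?_
    simp only [Real.ofDigitsTerm]
    generalize d n = k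
    fin_cases k <;> simp
end

section
/- Let n ≥ 2 and let U, V ⊆ ℝⁿ be disjoint open sets such that the complement ℝⁿ ∖ (U ∪ V) has cardinality strictly less than 2^ℵ₀. Then U = ∅ or V = ∅. -/
/-- For `n ≥ 2`, if `U, V ⊆ ℝⁿ` are disjoint open sets whose
complement `ℝⁿ ∖ (U ∪ V)` has cardinality `< 2^ℵ₀`, then `U = ∅` or `V = ∅`. -/
theorem stmt_16 (n : ℕ) (hn : 2 ≤ n) (U V : Set (Fin n → ℝ))
    (hU : IsOpen U) (hV : IsOpen V) (hUV : Disjoint U V)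
    (hcompl : Cardinal.mk ((U ∪ V)ᶜ : Set (Fin n → ℝ)) < 2 ^ Cardinal.aleph0) :
    U = ∅ ∨ V = ∅ := by
  by_contra hne
  rw [not_or, ← Ne, ← Ne, ← Set.nonempty_iff_ne_empty, ← Set.nonempty_iff_ne_empty] at hne
  obtain ⟨⟨a, ha⟩, ⟨b, hb⟩⟩ := hne
  have hab : b - a ≠ 0 := by
    intro h
    rw [sub_eq_zero] at h
    exact Set.disjoint_left.1 hUV ha (h ▸ hb)
  have hrank : 1 < Module.rank ℝ (Fin n → ℝ) := by
    rw [rank_fin_fun]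
    exact_mod_cast hn
  obtain ⟨y, hy⟩ := exists_linearIndependent_pair_of_one_lt_rank hrank hab
  rw [LinearIndependent.pair_iff] at hy
  -- translates of the segment by small multiples of `y` still join `U` to `V`
  have hopen : IsOpen {t : ℝ | a + t • y ∈ U ∧ b + t • y ∈ V} :=
    (hU.preimage (by fun_prop : Continuous fun t : ℝ => a + t • y)).inter
      (hV.preimage (by fun_prop : Continuous fun t : ℝ => b + t • y))
  obtain ⟨ε, hε, hball⟩ := Metric.isOpen_iff.1 hopen 0 (by simpa using ⟨ha, hb⟩)
  rw [Real.ball_eq_Ioo] at hball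
  have key : ∀ t : Set.Ioo (0 - ε) (0 + ε), ∃ s : ℝ,
      a + (t : ℝ) • y + s • (b - a) ∈ (U ∪ V)ᶜ := by
    intro t
    obtain ⟨h1, h2⟩ := hball t.2
    by_contra! hcon
    have hc : Continuous fun s : ℝ => a + (t : ℝ) • y + s • (b - a) := by fun_prop
    have hpre := isPreconnected_univ (α := ℝ)
    obtain ⟨s, -, hs1, hs2⟩ := hpre _ _ (hU.preimage hc) (hV.preimage hc)
      (fun s _ => by
        have := hcon s
        rwa [Set.mem_compl_iff, not_not] at this)
      ⟨0, trivial, by simpa using h1⟩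
      ⟨1, trivial, by
        have : a + (t : ℝ) • y + (1 : ℝ) • (b - a) = b + (t : ℝ) • y := by module
        simpa only [Set.mem_preimage, this] using h2⟩
    exact Set.disjoint_left.1 hUV hs1 hs2
  choose s hs using key
  have hinj : Function.Injective
      (fun t => (⟨_, hs t⟩ : ((U ∪ V)ᶜ : Set (Fin n → ℝ)))) := by
    intro t t' h
    have h' : a + (t : ℝ) • y + s t • (b - a) = a + (t' : ℝ) • y + s t' • (b - a) :=
      congrArg Subtype.val h
    have := (hy (s t - s t') ((t : ℝ) - t') (by
      rw [← sub_eq_zero] at h'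
      rw [← h']
      module)).2
    exact Subtype.ext (sub_eq_zero.1 this)
  have hle := Cardinal.mk_le_of_injective hinj
  rw [Cardinal.mk_Ioo_real (by linarith)] at hle
  rw [Cardinal.two_power_aleph0] at hcompl
  exact absurd hcompl (not_lt.2 hle)
end
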